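/- Under the standing hypotheses in the context: if there is a faithful set of right integrals, then Ker(T₁) is the linear span of {a ⊗ b − (a ⊗ 1)·F₁·(1 ⊗ b) : a, b ∈ A} and Ker(T₃) is the linear span of {a ⊗ b − (1 ⊗ b)·F₃·(a ⊗ 1) : a, b ∈ A}; if there is a faithful set of left integrals, then Ker(T₂) is the linear span of {a ⊗ b − (a ⊗ 1)·F₂·(1 ⊗ b) : a, b ∈ A} and Ker(T₄) is the linear span of {a ⊗ b − (1 ⊗ b)·F₄·(a ⊗ 1) : a, b ∈ A}. -/

import Mathlib

open TensorProduct

/-- Slice map `id ⊗ ω` landing in the left tensor factor. -/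
noncomputable def sL {B C : Type} [AddCommGroup B] [Module ℂ B] [AddCommGroup C] [Module ℂ C]
    (ω : C →ₗ[ℂ] ℂ) : (B ⊗[ℂ] C) →ₗ[ℂ] B :=
  (TensorProduct.rid ℂ B).toLinearMap ∘ₗ LinearMap.lTensor B ω

/-- Slice map `ω ⊗ id` landing in the right tensor factor. -/
noncomputable def sR {B C : Type} [AddCommGroup B] [Module ℂ B] [AddCommGroup C] [Module ℂ C]
    (ω : B →ₗ[ℂ] ℂ) : (B ⊗[ℂ] C) →ₗ[ℂ] C :=
  (TensorProduct.lid ℂ C).toLinearMap ∘ₗ LinearMap.rTensor C ω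

/-- `u ⊗ v ↦ u ⊗ (v ⊗ 1)`, placing `A ⊗ A` in legs 1 and 2 of the triple tensor product. -/
noncomputable def leg12 (A : Type) [Ring A] [Algebra ℂ A] :
    (A ⊗[ℂ] A) →ₗ[ℂ] A ⊗[ℂ] (A ⊗[ℂ] A) :=
  TensorProduct.map LinearMap.id ((TensorProduct.mk ℂ A A).flip 1)

/-- `u ⊗ v ↦ u ⊗ (1 ⊗ v)`, placing `A ⊗ A` in legs 1 and 3 of the triple tensor product. -/
noncomputable def leg13 (A : Type) [Ring A] [Algebra ℂ A] :
    (A ⊗[ℂ] A) →ₗ[ℂ] A ⊗[ℂ] (A ⊗[ℂ] A) :=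
  TensorProduct.map LinearMap.id (TensorProduct.mk ℂ A A 1)

/-- A left integral: a nonzero functional with `(id ⊗ φ)(Δ a) ∈ C` for all `a`. -/
noncomputable def IsLeftIntegral (A : Type) [Ring A] [Algebra ℂ A] (Δ : A →ₗ[ℂ] A ⊗[ℂ] A)
    (C : Subalgebra ℂ A) (φ : A →ₗ[ℂ] ℂ) : Prop :=
  φ ≠ 0 ∧ ∀ a : A, sL φ (Δ a) ∈ C

/-- A right integral: a nonzero functional with `(ψ ⊗ id)(Δ a) ∈ B` for all `a`. -/
noncomputable def IsRightIntegral (A : Type) [Ring A] [Algebra ℂ A] (Δ : A →ₗ[ℂ] A ⊗[ℂ] A)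
    (B : Subalgebra ℂ A) (ψ : A →ₗ[ℂ] ℂ) : Prop :=
  ψ ≠ 0 ∧ ∀ a : A, sR ψ (Δ a) ∈ B

/-- There is a faithful set of left integrals. -/
noncomputable def FaithfulLeftIntegrals (A : Type) [Ring A] [Algebra ℂ A]
    (Δ : A →ₗ[ℂ] A ⊗[ℂ] A) (C : Subalgebra ℂ A) : Prop :=
  (∀ a : A, (∀ φ : A →ₗ[ℂ] ℂ, IsLeftIntegral A Δ C φ → ∀ b : A, φ (a * b) = 0) → a = 0) ∧
  (∀ a : A, (∀ φ : A →ₗ[ℂ] ℂ, IsLeftIntegral A Δ C φ → ∀ b : A, φ (b * a) = 0) → a = 0)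

/-- There is a faithful set of right integrals. -/
noncomputable def FaithfulRightIntegrals (A : Type) [Ring A] [Algebra ℂ A]
    (Δ : A →ₗ[ℂ] A ⊗[ℂ] A) (B : Subalgebra ℂ A) : Prop :=
  (∀ a : A, (∀ ψ : A →ₗ[ℂ] ℂ, IsRightIntegral A Δ B ψ → ∀ b : A, ψ (a * b) = 0) → a = 0) ∧
  (∀ a : A, (∀ ψ : A →ₗ[ℂ] ℂ, IsRightIntegral A Δ B ψ → ∀ b : A, ψ (b * a) = 0) → a = 0)

/-- `F₁ = (id ⊗ S_C)(E)` viewed in `A ⊗ A`. -/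
noncomputable def F1A (A : Type) [Ring A] [Algebra ℂ A] (B C : Subalgebra ℂ A)
    (E' : ↥B ⊗[ℂ] ↥C) (SC : ↥C ≃ₗ[ℂ] ↥B) : A ⊗[ℂ] A :=
  TensorProduct.map B.val.toLinearMap (B.val.toLinearMap ∘ₗ SC.toLinearMap) E'

/-- `F₂ = (S_B ⊗ id)(E)` viewed in `A ⊗ A`. -/
noncomputable def F2A (A : Type) [Ring A] [Algebra ℂ A] (B C : Subalgebra ℂ A)
    (E' : ↥B ⊗[ℂ] ↥C) (SB : ↥B ≃ₗ[ℂ] ↥C) : A ⊗[ℂ] A :=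
  TensorProduct.map (C.val.toLinearMap ∘ₗ SB.toLinearMap) C.val.toLinearMap E'

/-- `F₃ = (id ⊗ S_B⁻¹)(E)` viewed in `A ⊗ A`. -/
noncomputable def F3A (A : Type) [Ring A] [Algebra ℂ A] (B C : Subalgebra ℂ A)
    (E' : ↥B ⊗[ℂ] ↥C) (SB : ↥B ≃ₗ[ℂ] ↥C) : A ⊗[ℂ] A :=
  TensorProduct.map B.val.toLinearMap (B.val.toLinearMap ∘ₗ SB.symm.toLinearMap) E'

/-- `F₄ = (S_C⁻¹ ⊗ id)(E)` viewed in `A ⊗ A`. -/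
noncomputable def F4A (A : Type) [Ring A] [Algebra ℂ A] (B C : Subalgebra ℂ A)
    (E' : ↥B ⊗[ℂ] ↥C) (SC : ↥C ≃ₗ[ℂ] ↥B) : A ⊗[ℂ] A :=
  TensorProduct.map (C.val.toLinearMap ∘ₗ SC.symm.toLinearMap) C.val.toLinearMap E'

/-- `T₁ (a ⊗ b) = Δ(a) · (1 ⊗ b)`. -/
noncomputable def Tmap1 (A : Type) [Ring A] [Algebra ℂ A] (Δ : A →ₗ[ℂ] A ⊗[ℂ] A) :
    (A ⊗[ℂ] A) →ₗ[ℂ] A ⊗[ℂ] A :=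
  LinearMap.mul' ℂ (A ⊗[ℂ] A) ∘ₗ TensorProduct.map Δ (TensorProduct.mk ℂ A A 1)

/-- `T₂ (c ⊗ a) = (c ⊗ 1) · Δ(a)`. -/
noncomputable def Tmap2 (A : Type) [Ring A] [Algebra ℂ A] (Δ : A →ₗ[ℂ] A ⊗[ℂ] A) :
    (A ⊗[ℂ] A) →ₗ[ℂ] A ⊗[ℂ] A :=
  LinearMap.mul' ℂ (A ⊗[ℂ] A) ∘ₗ TensorProduct.map ((TensorProduct.mk ℂ A A).flip 1) Δ

/-- `T₃ (a ⊗ b) = (1 ⊗ b) · Δ(a)`. -/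
noncomputable def Tmap3 (A : Type) [Ring A] [Algebra ℂ A] (Δ : A →ₗ[ℂ] A ⊗[ℂ] A) :
    (A ⊗[ℂ] A) →ₗ[ℂ] A ⊗[ℂ] A :=
  (LinearMap.mul' ℂ (A ⊗[ℂ] A) ∘ₗ TensorProduct.map (TensorProduct.mk ℂ A A 1) Δ) ∘ₗ
    (TensorProduct.comm ℂ A A).toLinearMap

/-- `T₄ (c ⊗ a) = Δ(a) · (c ⊗ 1)`. -/
noncomputable def Tmap4 (A : Type) [Ring A] [Algebra ℂ A] (Δ : A →ₗ[ℂ] A ⊗[ℂ] A) :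
    (A ⊗[ℂ] A) →ₗ[ℂ] A ⊗[ℂ] A :=
  (LinearMap.mul' ℂ (A ⊗[ℂ] A) ∘ₗ TensorProduct.map Δ ((TensorProduct.mk ℂ A A).flip 1)) ∘ₗ
    (TensorProduct.comm ℂ A A).toLinearMap

section Slices

variable {A B C D : Type} [AddCommGroup A] [Module ℂ A] [AddCommGroup B] [Module ℂ B]
  [AddCommGroup C] [Module ℂ C] [AddCommGroup D] [Module ℂ D]

@[simp]
lemma sL_tmul (ω : C →ₗ[ℂ] ℂ) (b : B) (c : C) : sL ω (b ⊗ₜ[ℂ] c) = ω c • b := by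
  simp [sL]

@[simp]
lemma sR_tmul (ω : B →ₗ[ℂ] ℂ) (b : B) (c : C) : sR ω (b ⊗ₜ[ℂ] c) = ω b • c := by
  simp [sR]

lemma sR_comm (ω : C →ₗ[ℂ] ℂ) (x : B ⊗[ℂ] C) :
    sR ω (TensorProduct.comm ℂ B C x) = sL ω x := by
  induction x using TensorProduct.induction_on with
  | zero => simp
  | tmul b c => simp
  | add x y hx hy => simp only [map_add, hx, hy]

lemma sL_comm (ω : B →ₗ[ℂ] ℂ) (x : B ⊗[ℂ] C) :
    sL ω (TensorProduct.comm ℂ B C x) = sR ω x := by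
  induction x using TensorProduct.induction_on with
  | zero => simp
  | tmul b c => simp
  | add x y hx hy => simp only [map_add, hx, hy]

lemma sR_assoc (ω : B →ₗ[ℂ] ℂ) (x : (B ⊗[ℂ] C) ⊗[ℂ] D) :
    sR ω (TensorProduct.assoc ℂ B C D x) = LinearMap.rTensor D (sR ω) x := by
  induction x using TensorProduct.induction_on with
  | zero => simp
  | tmul u d =>
    induction u using TensorProduct.induction_on with
    | zero => simp
    | tmul b c => simp [TensorProduct.smul_tmul']
    | add x y hx hy => simp only [map_add, add_tmul, hx, hy]
  | add x y hx hy => simp only [map_add, hx, hy]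

lemma sR_lTensor (ω : B →ₗ[ℂ] ℂ) (f : C →ₗ[ℂ] D) (x : B ⊗[ℂ] C) :
    sR ω (LinearMap.lTensor B f x) = f (sR ω x) := by
  induction x using TensorProduct.induction_on with
  | zero => simp
  | tmul b c => simp
  | add x y hx hy => simp only [map_add, hx, hy]

lemma sL_rTensor (ω : C →ₗ[ℂ] ℂ) (f : B →ₗ[ℂ] D) (x : B ⊗[ℂ] C) :
    sL ω (LinearMap.rTensor C f x) = f (sL ω x) := by
  induction x using TensorProduct.induction_on with
  | zero => simp
  | tmul b c => simp
  | add x y hx hy => simp only [map_add, hx, hy]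

lemma sL_map (ω : D →ₗ[ℂ] ℂ) (f : B →ₗ[ℂ] A) (g : C →ₗ[ℂ] D) (x : B ⊗[ℂ] C) :
    sL ω (TensorProduct.map f g x) = f (sL (ω ∘ₗ g) x) := by
  induction x using TensorProduct.induction_on with
  | zero => simp
  | tmul b c => simp
  | add x y hx hy => simp only [map_add, hx, hy]

lemma functional_sL_eq_functional_sR (ψ : B →ₗ[ℂ] ℂ) (ω : C →ₗ[ℂ] ℂ) (x : B ⊗[ℂ] C) :
    ψ (sL ω x) = ω (sR ψ x) := by
  induction x using TensorProduct.induction_on with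
  | zero => simp
  | tmul b c => simp [mul_comm]
  | add x y hx hy => simp only [map_add, hx, hy]

lemma eq_zero_of_forall_sL_eq_zero (x : B ⊗[ℂ] C) (h : ∀ ω : C →ₗ[ℂ] ℂ, sL ω x = 0) :
    x = 0 := by
  classical
  let b := Module.Basis.ofVectorSpace ℂ C
  apply (TensorProduct.equivFinsuppOfBasisRight (M := B) b).injective
  ext i
  rw [map_zero, Finsupp.zero_apply, TensorProduct.equivFinsuppOfBasisRight_apply]
  exact h (b.coord i)

lemma eq_of_rTensor_eq {Δ : A →ₗ[ℂ] A ⊗[ℂ] A}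
    (hfull : Submodule.span ℂ {x : A | ∃ ω : A →ₗ[ℂ] ℂ, ∃ a : A, x = sL ω (Δ a)} = ⊤)
    {f g : A →ₗ[ℂ] D} (h : ∀ a, LinearMap.rTensor A f (Δ a) = LinearMap.rTensor A g (Δ a)) :
    f = g := by
  apply LinearMap.ext_on hfull
  rintro _ ⟨ω, a, rfl⟩
  rw [← sL_rTensor, ← sL_rTensor, h]

end Slices

section Products

variable {A : Type} [Ring A] [Algebra ℂ A]

@[simp]
lemma leg12_tmul (a b : A) : leg12 A (a ⊗ₜ[ℂ] b) = a ⊗ₜ[ℂ] (b ⊗ₜ[ℂ] (1 : A)) := rfl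

@[simp]
lemma leg13_tmul (a b : A) : leg13 A (a ⊗ₜ[ℂ] b) = a ⊗ₜ[ℂ] ((1 : A) ⊗ₜ[ℂ] b) := rfl

lemma leg13_mul (x y : A ⊗[ℂ] A) : leg13 A (x * y) = leg13 A x * leg13 A y := by
  induction x using TensorProduct.induction_on with
  | zero => simp
  | add x x' hx hx' => simp only [map_add, add_mul, hx, hx']
  | tmul a b =>
    induction y using TensorProduct.induction_on with
    | zero => simp
    | tmul c d => simp
    | add x y hx hy => simp only [map_add, mul_add, hx, hy]

lemma comm_mul {B C : Type} [Ring B] [Algebra ℂ B] [Ring C] [Algebra ℂ C] (x y : B ⊗[ℂ] C) :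
    TensorProduct.comm ℂ B C (x * y) = TensorProduct.comm ℂ B C x * TensorProduct.comm ℂ B C y :=
  map_mul (Algebra.TensorProduct.comm ℂ B C) x y

@[simp]
lemma Tmap1_tmul (Δ : A →ₗ[ℂ] A ⊗[ℂ] A) (a b : A) :
    Tmap1 A Δ (a ⊗ₜ[ℂ] b) = Δ a * ((1 : A) ⊗ₜ[ℂ] b) := rfl

@[simp]
lemma Tmap2_tmul (Δ : A →ₗ[ℂ] A ⊗[ℂ] A) (c a : A) :
    Tmap2 A Δ (c ⊗ₜ[ℂ] a) = (c ⊗ₜ[ℂ] (1 : A)) * Δ a := rfl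

@[simp]
lemma Tmap3_tmul (Δ : A →ₗ[ℂ] A ⊗[ℂ] A) (a b : A) :
    Tmap3 A Δ (a ⊗ₜ[ℂ] b) = ((1 : A) ⊗ₜ[ℂ] b) * Δ a := rfl

@[simp]
lemma Tmap4_tmul (Δ : A →ₗ[ℂ] A ⊗[ℂ] A) (c a : A) :
    Tmap4 A Δ (c ⊗ₜ[ℂ] a) = Δ a * (c ⊗ₜ[ℂ] (1 : A)) := rfl

lemma sR_mul_one_tmul (ψ : A →ₗ[ℂ] ℂ) (x : A ⊗[ℂ] A) (b : A) :
    sR ψ (x * ((1 : A) ⊗ₜ[ℂ] b)) = sR ψ x * b := by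
  induction x using TensorProduct.induction_on with
  | zero => simp
  | tmul c d => simp
  | add x y hx hy => simp only [map_add, add_mul, hx, hy]

lemma sR_one_tmul_mul (ψ : A →ₗ[ℂ] ℂ) (x : A ⊗[ℂ] A) (b : A) :
    sR ψ (((1 : A) ⊗ₜ[ℂ] b) * x) = b * sR ψ x := by
  induction x using TensorProduct.induction_on with
  | zero => simp
  | tmul c d => simp
  | add x y hx hy => simp only [map_add, mul_add, hx, hy]

lemma sR_leg13_mul_one_tmul (ψ : A →ₗ[ℂ] ℂ) (x y : A ⊗[ℂ] A) :
    sR ψ (leg13 A x * ((1 : A) ⊗ₜ[ℂ] y)) = ((1 : A) ⊗ₜ[ℂ] sR ψ x) * y := by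
  induction x using TensorProduct.induction_on with
  | zero => simp
  | tmul c d => simp
  | add x y hx hy => simp only [map_add, add_mul, tmul_add, hx, hy]

lemma sR_one_tmul_mul_leg13 (ψ : A →ₗ[ℂ] ℂ) (x y : A ⊗[ℂ] A) :
    sR ψ (((1 : A) ⊗ₜ[ℂ] y) * leg13 A x) = y * ((1 : A) ⊗ₜ[ℂ] sR ψ x) := by
  induction x using TensorProduct.induction_on with
  | zero => simp
  | tmul c d => simp
  | add x y hx hy => simp only [map_add, mul_add, tmul_add, hx, hy]

lemma sR_leg12_mul_one_tmul (ω : A →ₗ[ℂ] ℂ) (x y : A ⊗[ℂ] A) :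
    sR ω (leg12 A x * ((1 : A) ⊗ₜ[ℂ] y)) = (sR ω x ⊗ₜ[ℂ] (1 : A)) * y := by
  induction x using TensorProduct.induction_on with
  | zero => simp
  | tmul c d => simp [← TensorProduct.smul_tmul']
  | add x y hx hy => simp only [map_add, add_mul, add_tmul, hx, hy]

lemma sR_one_tmul_mul_leg12 (ω : A →ₗ[ℂ] ℂ) (x y : A ⊗[ℂ] A) :
    sR ω (((1 : A) ⊗ₜ[ℂ] y) * leg12 A x) = y * (sR ω x ⊗ₜ[ℂ] (1 : A)) := by
  induction x using TensorProduct.induction_on with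
  | zero => simp
  | tmul c d => simp [← TensorProduct.smul_tmul']
  | add x y hx hy => simp only [map_add, mul_add, add_tmul, hx, hy]

lemma sL_assoc_symm_leg12_mul (ω : A →ₗ[ℂ] ℂ) (x y : A ⊗[ℂ] A) :
    sL ω ((TensorProduct.assoc ℂ A A A).symm (leg12 A x * ((1 : A) ⊗ₜ[ℂ] y))) =
      x * ((1 : A) ⊗ₜ[ℂ] sL ω y) := by
  induction x using TensorProduct.induction_on with
  | zero => simp
  | add x x' hx hx' => simp only [map_add, add_mul, hx, hx']
  | tmul a b =>
    induction y using TensorProduct.induction_on with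
    | zero => simp
    | tmul c d => simp
    | add x y hx hy => simp only [map_add, mul_add, tmul_add, hx, hy]

lemma sL_assoc_symm_mul_leg12 (ω : A →ₗ[ℂ] ℂ) (x y : A ⊗[ℂ] A) :
    sL ω ((TensorProduct.assoc ℂ A A A).symm (((1 : A) ⊗ₜ[ℂ] y) * leg12 A x)) =
      ((1 : A) ⊗ₜ[ℂ] sL ω y) * x := by
  induction x using TensorProduct.induction_on with
  | zero => simp
  | add x x' hx hx' => simp only [map_add, mul_add, hx, hx']
  | tmul a b =>
    induction y using TensorProduct.induction_on with
    | zero => simp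
    | tmul c d => simp
    | add x y hx hy => simp only [map_add, add_mul, tmul_add, hx, hy]

lemma sL_tmul_one_mul (ω : A →ₗ[ℂ] ℂ) (x : A ⊗[ℂ] A) (b : A) :
    sL ω ((b ⊗ₜ[ℂ] (1 : A)) * x) = b * sL ω x := by
  induction x using TensorProduct.induction_on with
  | zero => simp
  | tmul c d => simp
  | add x y hx hy => simp only [map_add, mul_add, hx, hy]

lemma sL_mul_tmul_one (ω : A →ₗ[ℂ] ℂ) (x : A ⊗[ℂ] A) (b : A) :
    sL ω (x * (b ⊗ₜ[ℂ] (1 : A))) = sL ω x * b := by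
  induction x using TensorProduct.induction_on with
  | zero => simp
  | tmul c d => simp
  | add x y hx hy => simp only [map_add, add_mul, hx, hy]

lemma sR_leg13_mul_leg12 (ψ : A →ₗ[ℂ] ℂ) (F : A ⊗[ℂ] A) (c d : A) :
    sR ψ (leg13 A (c ⊗ₜ[ℂ] d) * leg12 A F) = sR ψ ((c ⊗ₜ[ℂ] (1 : A)) * F) ⊗ₜ[ℂ] d := by
  induction F using TensorProduct.induction_on with
  | zero => simp
  | tmul e f => simp [TensorProduct.smul_tmul']
  | add x y hx hy => simp only [map_add, mul_add, add_tmul, hx, hy]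

lemma sR_leg12_mul_leg13 (ψ : A →ₗ[ℂ] ℂ) (F : A ⊗[ℂ] A) (c d : A) :
    sR ψ (leg12 A F * leg13 A (c ⊗ₜ[ℂ] d)) = sR ψ (F * (c ⊗ₜ[ℂ] (1 : A))) ⊗ₜ[ℂ] d := by
  induction F using TensorProduct.induction_on with
  | zero => simp
  | tmul e f => simp [TensorProduct.smul_tmul']
  | add x y hx hy => simp only [map_add, add_mul, add_tmul, hx, hy]

lemma leg13_mul_tmul (x : A ⊗[ℂ] A) (u v w : A) :
    leg13 A x * (u ⊗ₜ[ℂ] (v ⊗ₜ[ℂ] w)) =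
      leg13 A (x * (u ⊗ₜ[ℂ] w)) * ((1 : A) ⊗ₜ[ℂ] (v ⊗ₜ[ℂ] (1 : A))) := by
  rw [leg13_mul, mul_assoc]
  simp

lemma tmul_mul_leg13 (x : A ⊗[ℂ] A) (u v w : A) :
    (u ⊗ₜ[ℂ] (v ⊗ₜ[ℂ] w)) * leg13 A x =
      ((1 : A) ⊗ₜ[ℂ] (v ⊗ₜ[ℂ] (1 : A))) * leg13 A ((u ⊗ₜ[ℂ] w) * x) := by
  rw [leg13_mul, ← mul_assoc]
  simp

/-- The linear map `a ⊗ b ↦ (a ⊗ 1) F (1 ⊗ b)`. -/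
noncomputable def sandwich (F : A ⊗[ℂ] A) : A ⊗[ℂ] A →ₗ[ℂ] A ⊗[ℂ] A :=
  TensorProduct.lift
    ((LinearMap.mul ℂ (A ⊗[ℂ] A)).compl₁₂
      (LinearMap.mulRight ℂ F ∘ₗ (TensorProduct.mk ℂ A A).flip 1) (TensorProduct.mk ℂ A A 1))

@[simp]
lemma sandwich_tmul (F : A ⊗[ℂ] A) (a b : A) :
    sandwich F (a ⊗ₜ[ℂ] b) = (a ⊗ₜ[ℂ] (1 : A)) * F * ((1 : A) ⊗ₜ[ℂ] b) := rfl

/-- The linear map `a ⊗ b ↦ (1 ⊗ b) F (a ⊗ 1)`. -/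
noncomputable def reverseSandwich (F : A ⊗[ℂ] A) : A ⊗[ℂ] A →ₗ[ℂ] A ⊗[ℂ] A :=
  TensorProduct.lift
    ((LinearMap.mul ℂ (A ⊗[ℂ] A)).compl₁₂
      (LinearMap.mulRight ℂ F ∘ₗ TensorProduct.mk ℂ A A 1)
      ((TensorProduct.mk ℂ A A).flip 1)).flip

@[simp]
lemma reverseSandwich_tmul (F : A ⊗[ℂ] A) (a b : A) :
    reverseSandwich F (a ⊗ₜ[ℂ] b) = ((1 : A) ⊗ₜ[ℂ] b) * F * (a ⊗ₜ[ℂ] (1 : A)) := rfl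

end Products

/-- If `T ∘ P = T` and `P` vanishes on the kernel of `T`, then that kernel is spanned by the
elements `a ⊗ b - P (a ⊗ b)`. -/
lemma ker_eq_span_tmul_sub {V W X : Type} [AddCommGroup V] [Module ℂ V] [AddCommGroup W]
    [Module ℂ W] [AddCommGroup X] [Module ℂ X] (T : V ⊗[ℂ] W →ₗ[ℂ] X)
    (P : V ⊗[ℂ] W →ₗ[ℂ] V ⊗[ℂ] W) (hTP : ∀ a b, T (P (a ⊗ₜ b)) = T (a ⊗ₜ b))
    (hP : ∀ w, T w = 0 → P w = 0) :
    LinearMap.ker T = Submodule.span ℂ {w | ∃ a b, w = a ⊗ₜ[ℂ] b - P (a ⊗ₜ b)} := by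
  apply le_antisymm
  · intro w hw
    have key : ∀ w, w - P w ∈ Submodule.span ℂ {w | ∃ a b, w = a ⊗ₜ[ℂ] b - P (a ⊗ₜ b)} := by
      intro w
      induction w using TensorProduct.induction_on with
      | zero => simp
      | tmul a b => exact Submodule.subset_span ⟨a, b, rfl⟩
      | add x y hx hy =>
        rw [map_add, add_sub_add_comm]
        exact Submodule.add_mem _ hx hy
    simpa [hP w hw] using key w
  · rw [Submodule.span_le]
    rintro _ ⟨a, b, rfl⟩
    simp [hTP]

section Integrals

variable {A : Type} [Ring A] [Algebra ℂ A] {Δ : A →ₗ[ℂ] A ⊗[ℂ] A} {B : Subalgebra ℂ A}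
  {E F : A ⊗[ℂ] A}

lemma rTensor_sR_comp
    (hΔcoassoc : ∀ a : A,
      TensorProduct.assoc ℂ A A A (LinearMap.rTensor A Δ (Δ a)) = LinearMap.lTensor A Δ (Δ a))
    (ψ : A →ₗ[ℂ] ℂ) (a : A) :
    LinearMap.rTensor A (sR ψ ∘ₗ Δ) (Δ a) = Δ (sR ψ (Δ a)) := by
  rw [LinearMap.rTensor_comp, LinearMap.comp_apply, ← sR_assoc, hΔcoassoc, sR_lTensor]

lemma sR_tmul_one_mul_eq
    (hΔcoassoc : ∀ a : A,
      TensorProduct.assoc ℂ A A A (LinearMap.rTensor A Δ (Δ a)) = LinearMap.lTensor A Δ (Δ a))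
    (hΔfull : Submodule.span ℂ {x : A | ∃ ω : A →ₗ[ℂ] ℂ, ∃ a : A, x = sL ω (Δ a)} = ⊤)
    (hΔE : ∀ a, Δ a * E = Δ a)
    (hΔB : ∀ b ∈ B, Δ b = ((1 : A) ⊗ₜ[ℂ] b) * E)
    (hF : leg13 A E * leg12 A F = leg13 A E * ((1 : A) ⊗ₜ[ℂ] E))
    {ψ : A →ₗ[ℂ] ℂ} (hψ : IsRightIntegral A Δ B ψ) (a : A) :
    sR ψ ((a ⊗ₜ[ℂ] (1 : A)) * F) = sR ψ (Δ a) := by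
  let G : A →ₗ[ℂ] A := sR ψ ∘ₗ LinearMap.mulRight ℂ F ∘ₗ (TensorProduct.mk ℂ A A).flip 1
  have hG : ∀ u : A ⊗[ℂ] A,
      LinearMap.rTensor A G u = sR ψ (leg13 A u * leg12 A F) := by
    intro u
    induction u using TensorProduct.induction_on with
    | zero => simp
    | add x y hx hy => simp only [map_add, add_mul, hx, hy]
    | tmul c d => rw [sR_leg13_mul_leg12]; rfl
  refine LinearMap.congr_fun (eq_of_rTensor_eq hΔfull (f := G) (g := sR ψ ∘ₗ Δ) fun a ↦ ?_) a
  rw [rTensor_sR_comp hΔcoassoc, hG, hΔB _ (hψ.2 a), ← hΔE, leg13_mul, mul_assoc, hF, ← mul_assoc,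
    ← leg13_mul, hΔE, sR_leg13_mul_one_tmul]

lemma sR_mul_tmul_one_eq
    (hΔcoassoc : ∀ a : A,
      TensorProduct.assoc ℂ A A A (LinearMap.rTensor A Δ (Δ a)) = LinearMap.lTensor A Δ (Δ a))
    (hΔfull : Submodule.span ℂ {x : A | ∃ ω : A →ₗ[ℂ] ℂ, ∃ a : A, x = sL ω (Δ a)} = ⊤)
    (hEΔ : ∀ a, E * Δ a = Δ a)
    (hΔB : ∀ b ∈ B, Δ b = E * ((1 : A) ⊗ₜ[ℂ] b))
    (hF : leg12 A F * leg13 A E = ((1 : A) ⊗ₜ[ℂ] E) * leg13 A E)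
    {ψ : A →ₗ[ℂ] ℂ} (hψ : IsRightIntegral A Δ B ψ) (a : A) :
    sR ψ (F * (a ⊗ₜ[ℂ] (1 : A))) = sR ψ (Δ a) := by
  let G : A →ₗ[ℂ] A := sR ψ ∘ₗ LinearMap.mulLeft ℂ F ∘ₗ (TensorProduct.mk ℂ A A).flip 1
  have hG : ∀ u : A ⊗[ℂ] A,
      LinearMap.rTensor A G u = sR ψ (leg12 A F * leg13 A u) := by
    intro u
    induction u using TensorProduct.induction_on with
    | zero => simp
    | add x y hx hy => simp only [map_add, mul_add, hx, hy]
    | tmul c d => rw [sR_leg12_mul_leg13]; rfl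
  refine LinearMap.congr_fun (eq_of_rTensor_eq hΔfull (f := G) (g := sR ψ ∘ₗ Δ) fun a ↦ ?_) a
  rw [rTensor_sR_comp hΔcoassoc, hG, hΔB _ (hψ.2 a), ← hEΔ, leg13_mul, ← mul_assoc, hF, mul_assoc,
    ← leg13_mul, hEΔ, sR_one_tmul_mul_leg13]

lemma eq_zero_of_sR_tmul_one_mul (hfaith : FaithfulRightIntegrals A Δ B) (t : A ⊗[ℂ] A)
    (h : ∀ ψ, IsRightIntegral A Δ B ψ → ∀ x : A, sR ψ ((x ⊗ₜ[ℂ] (1 : A)) * t) = 0) : t = 0 := by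
  refine eq_zero_of_forall_sL_eq_zero t fun ω ↦ hfaith.2 _ fun ψ hψ x ↦ ?_
  rw [← sL_tmul_one_mul, functional_sL_eq_functional_sR, h ψ hψ, map_zero]

lemma eq_zero_of_sR_mul_tmul_one (hfaith : FaithfulRightIntegrals A Δ B) (t : A ⊗[ℂ] A)
    (h : ∀ ψ, IsRightIntegral A Δ B ψ → ∀ x : A, sR ψ (t * (x ⊗ₜ[ℂ] (1 : A))) = 0) : t = 0 := by
  refine eq_zero_of_forall_sL_eq_zero t fun ω ↦ hfaith.1 _ fun ψ hψ x ↦ ?_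
  rw [← sL_mul_tmul_one, functional_sL_eq_functional_sR, h ψ hψ, map_zero]

lemma Tmap1_sandwich (hΔmul : ∀ a a' : A, Δ (a * a') = Δ a * Δ a') (a b : A) :
    Tmap1 A Δ (sandwich F (a ⊗ₜ[ℂ] b)) = Δ a * Tmap1 A Δ F * ((1 : A) ⊗ₜ[ℂ] b) := by
  rw [sandwich_tmul]
  induction F using TensorProduct.induction_on with
  | zero => simp
  | tmul c d => simp [hΔmul, mul_assoc]
  | add x y hx hy => simp only [map_add, mul_add, add_mul, hx, hy]

lemma Tmap3_reverseSandwich (hΔmul : ∀ a a' : A, Δ (a * a') = Δ a * Δ a') (a b : A) :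
    Tmap3 A Δ (reverseSandwich F (a ⊗ₜ[ℂ] b)) = ((1 : A) ⊗ₜ[ℂ] b) * Tmap3 A Δ F * Δ a := by
  rw [reverseSandwich_tmul]
  induction F using TensorProduct.induction_on with
  | zero => simp
  | tmul c d =>
    have : ((1 : A) ⊗ₜ[ℂ] (b * d)) = ((1 : A) ⊗ₜ[ℂ] b) * ((1 : A) ⊗ₜ[ℂ] d) := by simp
    simp only [Algebra.TensorProduct.tmul_mul_tmul, one_mul, mul_one, Tmap3_tmul, hΔmul]
    rw [this]
    simp only [mul_assoc]
  | add x y hx hy => simp only [map_add, mul_add, add_mul, hx, hy]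

lemma ker_Tmap1_eq_span (hΔmul : ∀ a a' : A, Δ (a * a') = Δ a * Δ a')
    (hΔcoassoc : ∀ a : A,
      TensorProduct.assoc ℂ A A A (LinearMap.rTensor A Δ (Δ a)) = LinearMap.lTensor A Δ (Δ a))
    (hΔfull : Submodule.span ℂ {x : A | ∃ ω : A →ₗ[ℂ] ℂ, ∃ a : A, x = sL ω (Δ a)} = ⊤)
    (hΔE : ∀ a, Δ a * E = Δ a)
    (hΔB : ∀ b ∈ B, Δ b = ((1 : A) ⊗ₜ[ℂ] b) * E)
    (hF : leg13 A E * leg12 A F = leg13 A E * ((1 : A) ⊗ₜ[ℂ] E))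
    (hTF : Tmap1 A Δ F = E) (hfaith : FaithfulRightIntegrals A Δ B) :
    LinearMap.ker (Tmap1 A Δ) = Submodule.span ℂ {w : A ⊗[ℂ] A | ∃ a b : A,
        w = a ⊗ₜ[ℂ] b - (a ⊗ₜ[ℂ] (1 : A)) * F * ((1 : A) ⊗ₜ[ℂ] b)} := by
  refine ker_eq_span_tmul_sub _ (sandwich F) (fun a b ↦ ?_) fun w hw ↦ ?_
  · rw [Tmap1_sandwich hΔmul, hTF, hΔE, Tmap1_tmul]
  · refine eq_zero_of_sR_tmul_one_mul hfaith _ fun ψ hψ x ↦ ?_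
    have key : ∀ w, sR ψ ((x ⊗ₜ[ℂ] (1 : A)) * sandwich F w) = sR ψ (Δ x * Tmap1 A Δ w) := by
      intro w
      induction w using TensorProduct.induction_on with
      | zero => simp
      | add x y hx hy => simp only [map_add, mul_add, hx, hy]
      | tmul a b =>
        rw [sandwich_tmul, Tmap1_tmul, ← mul_assoc, ← mul_assoc, ← mul_assoc,
          Algebra.TensorProduct.tmul_mul_tmul, mul_one, sR_mul_one_tmul, sR_mul_one_tmul,
          sR_tmul_one_mul_eq hΔcoassoc hΔfull hΔE hΔB hF hψ, hΔmul]
    rw [key, hw, mul_zero, map_zero]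

lemma ker_Tmap3_eq_span (hΔmul : ∀ a a' : A, Δ (a * a') = Δ a * Δ a')
    (hΔcoassoc : ∀ a : A,
      TensorProduct.assoc ℂ A A A (LinearMap.rTensor A Δ (Δ a)) = LinearMap.lTensor A Δ (Δ a))
    (hΔfull : Submodule.span ℂ {x : A | ∃ ω : A →ₗ[ℂ] ℂ, ∃ a : A, x = sL ω (Δ a)} = ⊤)
    (hEΔ : ∀ a, E * Δ a = Δ a)
    (hΔB : ∀ b ∈ B, Δ b = E * ((1 : A) ⊗ₜ[ℂ] b))
    (hF : leg12 A F * leg13 A E = ((1 : A) ⊗ₜ[ℂ] E) * leg13 A E)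
    (hTF : Tmap3 A Δ F = E) (hfaith : FaithfulRightIntegrals A Δ B) :
    LinearMap.ker (Tmap3 A Δ) = Submodule.span ℂ {w : A ⊗[ℂ] A | ∃ a b : A,
        w = a ⊗ₜ[ℂ] b - ((1 : A) ⊗ₜ[ℂ] b) * F * (a ⊗ₜ[ℂ] (1 : A))} := by
  refine ker_eq_span_tmul_sub _ (reverseSandwich F) (fun a b ↦ ?_) fun w hw ↦ ?_
  · rw [Tmap3_reverseSandwich hΔmul, hTF, mul_assoc, hEΔ, Tmap3_tmul]
  · refine eq_zero_of_sR_mul_tmul_one hfaith _ fun ψ hψ x ↦ ?_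
    have key : ∀ w,
        sR ψ (reverseSandwich F w * (x ⊗ₜ[ℂ] (1 : A))) = sR ψ (Tmap3 A Δ w * Δ x) := by
      intro w
      induction w using TensorProduct.induction_on with
      | zero => simp
      | add x y hx hy => simp only [map_add, add_mul, hx, hy]
      | tmul a b =>
        rw [reverseSandwich_tmul, Tmap3_tmul, mul_assoc, mul_assoc, mul_assoc,
          Algebra.TensorProduct.tmul_mul_tmul, mul_one, sR_one_tmul_mul, sR_one_tmul_mul,
          sR_mul_tmul_one_eq hΔcoassoc hΔfull hEΔ hΔB hF hψ, hΔmul]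
    rw [key, hw, zero_mul, map_zero]

end Integrals

section Separability

variable {B C : Type} [Ring B] [Algebra ℂ B] [Ring C] [Algebra ℂ C]

lemma map_one_of_antimultiplicative (S : B ≃ₗ[ℂ] C) (hS : ∀ b b' : B, S (b * b') = S b' * S b) :
    S 1 = 1 := by
  have h := hS (S.symm 1) 1
  simpa using h.symm

lemma symm_antimultiplicative (S : B ≃ₗ[ℂ] C) (hS : ∀ b b' : B, S (b * b') = S b' * S b)
    (c c' : C) : S.symm (c * c') = S.symm c' * S.symm c := by
  apply S.injective
  simp [hS]

/-- The linear map `b ⊗ c ↦ S_C(c) ⊗ S_B(b)`. -/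
noncomputable def antipodeFlip (SB : B ≃ₗ[ℂ] C) (SC : C ≃ₗ[ℂ] B) : B ⊗[ℂ] C ≃ₗ[ℂ] B ⊗[ℂ] C :=
  TensorProduct.congr SB SC ≪≫ₗ TensorProduct.comm ℂ C B

@[simp]
lemma antipodeFlip_tmul (SB : B ≃ₗ[ℂ] C) (SC : C ≃ₗ[ℂ] B) (b : B) (c : C) :
    antipodeFlip SB SC (b ⊗ₜ c) = SC c ⊗ₜ SB b := rfl

@[simp]
lemma antipodeFlip_symm_tmul (SB : B ≃ₗ[ℂ] C) (SC : C ≃ₗ[ℂ] B) (b : B) (c : C) :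
    (antipodeFlip SB SC).symm (b ⊗ₜ c) = SB.symm c ⊗ₜ SC.symm b := rfl

variable {E : B ⊗[ℂ] C} {SB : B ≃ₗ[ℂ] C} {SC : C ≃ₗ[ℂ] B}

lemma antipodeFlip_mul (hSB : ∀ b b' : B, SB (b * b') = SB b' * SB b)
    (hSC : ∀ c c' : C, SC (c * c') = SC c' * SC c) (x y : B ⊗[ℂ] C) :
    antipodeFlip SB SC (x * y) = antipodeFlip SB SC y * antipodeFlip SB SC x := by
  induction x using TensorProduct.induction_on with
  | zero => simp
  | add x x' hx hx' => simp only [map_add, add_mul, mul_add, hx, hx']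
  | tmul a b =>
    induction y using TensorProduct.induction_on with
    | zero => simp
    | tmul c d => simp [hSB, hSC]
    | add x y hx hy => simp only [map_add, add_mul, mul_add, hx, hy]

lemma mul'_map_id_right_antipode (hEE : E * E = E)
    (hfull : Submodule.span ℂ {x : B | ∃ ω : C →ₗ[ℂ] ℂ, x = sL ω E} = ⊤)
    (hSCrel : ∀ c : C, ((1 : B) ⊗ₜ[ℂ] c) * E = (SC c ⊗ₜ[ℂ] (1 : C)) * E) :
    LinearMap.mul' ℂ B (TensorProduct.map LinearMap.id SC.toLinearMap E) = 1 := by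
  have key : ∀ z : B ⊗[ℂ] C, z * E =
      (LinearMap.mul' ℂ B (TensorProduct.map LinearMap.id SC.toLinearMap z) ⊗ₜ[ℂ] (1 : C)) * E := by
    intro z
    induction z using TensorProduct.induction_on with
    | zero => simp
    | add x y hx hy => simp only [map_add, add_tmul, add_mul, hx, hy]
    | tmul b c =>
      have h1 : b ⊗ₜ[ℂ] c = (b ⊗ₜ[ℂ] (1 : C)) * ((1 : B) ⊗ₜ[ℂ] c) := by simp
      rw [h1, mul_assoc, hSCrel, ← mul_assoc]
      simp
  have hslice (ω : C →ₗ[ℂ] ℂ) (x : B) (z : B ⊗[ℂ] C) :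
      sL ω ((x ⊗ₜ[ℂ] (1 : C)) * z) = x * sL ω z := by
    induction z using TensorProduct.induction_on with
    | zero => simp
    | tmul c d => simp
    | add x y hx hy => simp only [map_add, mul_add, hx, hy]
  have hid : LinearMap.mulLeft ℂ
      (LinearMap.mul' ℂ B (TensorProduct.map LinearMap.id SC.toLinearMap E)) = LinearMap.id := by
    apply LinearMap.ext_on hfull
    rintro _ ⟨ω, rfl⟩
    rw [LinearMap.mulLeft_apply, ← hslice, ← key, hEE, LinearMap.id_apply]
  simpa using LinearMap.congr_fun hid 1

lemma mul'_map_left_antipode_id (hEE : E * E = E)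
    (hfull : Submodule.span ℂ {y : C | ∃ ω : B →ₗ[ℂ] ℂ, y = sR ω E} = ⊤)
    (hSBrel : ∀ b : B, E * (b ⊗ₜ[ℂ] (1 : C)) = E * ((1 : B) ⊗ₜ[ℂ] SB b)) :
    LinearMap.mul' ℂ C (TensorProduct.map SB.toLinearMap LinearMap.id E) = 1 := by
  have key : ∀ z : B ⊗[ℂ] C, E * z =
      E * ((1 : B) ⊗ₜ[ℂ] LinearMap.mul' ℂ C (TensorProduct.map SB.toLinearMap LinearMap.id z)) := by
    intro z
    induction z using TensorProduct.induction_on with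
    | zero => simp
    | add x y hx hy => simp only [map_add, tmul_add, mul_add, hx, hy]
    | tmul b c =>
      have h1 : b ⊗ₜ[ℂ] c = (b ⊗ₜ[ℂ] (1 : C)) * ((1 : B) ⊗ₜ[ℂ] c) := by simp
      rw [h1, ← mul_assoc, hSBrel, mul_assoc]
      simp
  have hslice (ω : B →ₗ[ℂ] ℂ) (x : C) (z : B ⊗[ℂ] C) :
      sR ω (z * ((1 : B) ⊗ₜ[ℂ] x)) = sR ω z * x := by
    induction z using TensorProduct.induction_on with
    | zero => simp
    | tmul c d => simp
    | add x y hx hy => simp only [map_add, add_mul, hx, hy]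
  have hid : LinearMap.mulRight ℂ
      (LinearMap.mul' ℂ C (TensorProduct.map SB.toLinearMap LinearMap.id E)) = LinearMap.id := by
    apply LinearMap.ext_on hfull
    rintro _ ⟨ω, rfl⟩
    rw [LinearMap.mulRight_apply, ← hslice, ← key, hEE, LinearMap.id_apply]
  simpa using LinearMap.congr_fun hid 1

lemma antipodeFlip_eq_self (hEE : E * E = E)
    (hfull : Submodule.span ℂ {x : B | ∃ ω : C →ₗ[ℂ] ℂ, x = sL ω E} = ⊤)
    (hSB : ∀ b b' : B, SB (b * b') = SB b' * SB b)
    (hSC : ∀ c c' : C, SC (c * c') = SC c' * SC c)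
    (hSBrel : ∀ b : B, E * (b ⊗ₜ[ℂ] (1 : C)) = E * ((1 : B) ⊗ₜ[ℂ] SB b))
    (hSCrel : ∀ c : C, ((1 : B) ⊗ₜ[ℂ] c) * E = (SC c ⊗ₜ[ℂ] (1 : C)) * E) :
    antipodeFlip SB SC E = E := by
  have hm := mul'_map_id_right_antipode hEE hfull hSCrel
  have hX : ∀ c : C, ((1 : B) ⊗ₜ[ℂ] c) * antipodeFlip SB SC E =
      (SC c ⊗ₜ[ℂ] (1 : C)) * antipodeFlip SB SC E := by
    intro c
    have h := congrArg (antipodeFlip SB SC) (hSBrel (SB.symm c))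
    rw [antipodeFlip_mul hSB hSC, antipodeFlip_mul hSB hSC] at h
    simpa [map_one_of_antimultiplicative SB hSB, map_one_of_antimultiplicative SC hSC] using h
  have hleft : ∀ z : B ⊗[ℂ] C, z * antipodeFlip SB SC E =
      (LinearMap.mul' ℂ B (TensorProduct.map LinearMap.id SC.toLinearMap z) ⊗ₜ[ℂ] (1 : C)) *
        antipodeFlip SB SC E := by
    intro z
    induction z using TensorProduct.induction_on with
    | zero => simp
    | add x y hx hy => simp only [map_add, add_tmul, add_mul, hx, hy]
    | tmul b c =>
      have h1 : b ⊗ₜ[ℂ] c = (b ⊗ₜ[ℂ] (1 : C)) * ((1 : B) ⊗ₜ[ℂ] c) := by simp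
      rw [h1, mul_assoc, hX, ← mul_assoc]
      simp
  have hright : ∀ z : B ⊗[ℂ] C, E * antipodeFlip SB SC z =
      E * (LinearMap.mul' ℂ B (TensorProduct.map LinearMap.id SC.toLinearMap z) ⊗ₜ[ℂ] (1 : C)) := by
    intro z
    induction z using TensorProduct.induction_on with
    | zero => simp
    | add x y hx hy => simp only [map_add, add_tmul, mul_add, hx, hy]
    | tmul b c =>
      have h1 : antipodeFlip SB SC (b ⊗ₜ[ℂ] c) =
          ((1 : B) ⊗ₜ[ℂ] SB b) * (SC c ⊗ₜ[ℂ] (1 : C)) := by simp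
      rw [h1, ← mul_assoc, ← hSBrel, mul_assoc]
      simp
  have h1 := hleft E
  have h2 := hright E
  rw [hm, ← Algebra.TensorProduct.one_def] at h1 h2
  rw [one_mul] at h1
  rw [mul_one] at h2
  exact h1.symm.trans h2

end Separability

section Subalgebras

variable {A : Type} [Ring A] [Algebra ℂ A] {B C : Subalgebra ℂ A} {E : A ⊗[ℂ] A}
  {E' : ↥B ⊗[ℂ] ↥C} {SB : ↥B ≃ₗ[ℂ] ↥C} {SC : ↥C ≃ₗ[ℂ] ↥B} {Δ : A →ₗ[ℂ] A ⊗[ℂ] A}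

lemma map_val_mul (x y : ↥B ⊗[ℂ] ↥C) :
    TensorProduct.map B.val.toLinearMap C.val.toLinearMap (x * y) =
      TensorProduct.map B.val.toLinearMap C.val.toLinearMap x *
        TensorProduct.map B.val.toLinearMap C.val.toLinearMap y :=
  map_mul (Algebra.TensorProduct.map B.val C.val) x y

lemma map_val_injective :
    Function.Injective (TensorProduct.map B.val.toLinearMap C.val.toLinearMap) :=
  TensorProduct.map_injective_of_flat_flat _ _ Subtype.val_injective Subtype.val_injective

lemma leg13_mul_leg12_F1A
    (hE'E : TensorProduct.map B.val.toLinearMap C.val.toLinearMap E' = E)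
    (hflip : antipodeFlip SB SC E' = E')
    (hSBrel : ∀ b : ↥B, E' * (b ⊗ₜ[ℂ] (1 : ↥C)) = E' * ((1 : ↥B) ⊗ₜ[ℂ] SB b)) :
    leg13 A E * leg12 A (F1A A B C E' SC) = leg13 A E * ((1 : A) ⊗ₜ[ℂ] E) := by
  have hrel : ∀ b : ↥B, E * ((b : A) ⊗ₜ[ℂ] (1 : A)) = E * ((1 : A) ⊗ₜ[ℂ] (SB b : A)) := by
    intro b
    have h := congrArg (TensorProduct.map B.val.toLinearMap C.val.toLinearMap) (hSBrel b)
    rw [map_val_mul, map_val_mul, hE'E] at h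
    simpa using h
  have key : ∀ z : ↥B ⊗[ℂ] ↥C, leg13 A E * leg12 A (F1A A B C z SC) =
      leg13 A E * ((1 : A) ⊗ₜ[ℂ]
        TensorProduct.map B.val.toLinearMap C.val.toLinearMap (antipodeFlip SB SC z)) := by
    intro z
    induction z using TensorProduct.induction_on with
    | zero => simp [F1A]
    | add x y hx hy => simp only [F1A, map_add, tmul_add, mul_add] at hx hy ⊢; rw [hx, hy]
    | tmul b c =>
      simp only [F1A, map_tmul, leg12_tmul, antipodeFlip_tmul, AlgHom.toLinearMap_apply,
        LinearMap.comp_apply, LinearEquiv.coe_coe, Subalgebra.coe_val]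
      rw [leg13_mul_tmul, hrel, ← leg13_mul_tmul]
  rw [key, hflip, hE'E]

lemma leg12_F3A_mul_leg13
    (hE'E : TensorProduct.map B.val.toLinearMap C.val.toLinearMap E' = E)
    (hflip : antipodeFlip SB SC E' = E')
    (hSCrel : ∀ c : ↥C, ((1 : ↥B) ⊗ₜ[ℂ] c) * E' = (SC c ⊗ₜ[ℂ] (1 : ↥C)) * E') :
    leg12 A (F3A A B C E' SB) * leg13 A E = ((1 : A) ⊗ₜ[ℂ] E) * leg13 A E := by
  have hrel : ∀ b : ↥B, ((b : A) ⊗ₜ[ℂ] (1 : A)) * E = ((1 : A) ⊗ₜ[ℂ] (SC.symm b : A)) * E := by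
    intro b
    have h := congrArg (TensorProduct.map B.val.toLinearMap C.val.toLinearMap)
      (hSCrel (SC.symm b))
    rw [map_val_mul, map_val_mul, hE'E] at h
    simpa using h.symm
  have key : ∀ z : ↥B ⊗[ℂ] ↥C, leg12 A (F3A A B C z SB) * leg13 A E =
      ((1 : A) ⊗ₜ[ℂ] TensorProduct.map B.val.toLinearMap C.val.toLinearMap
        ((antipodeFlip SB SC).symm z)) * leg13 A E := by
    intro z
    induction z using TensorProduct.induction_on with
    | zero => simp [F3A]
    | add x y hx hy => simp only [F3A, map_add, tmul_add, add_mul] at hx hy ⊢; rw [hx, hy]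
    | tmul b c =>
      simp only [F3A, map_tmul, leg12_tmul, antipodeFlip_symm_tmul, AlgHom.toLinearMap_apply,
        LinearMap.comp_apply, LinearEquiv.coe_coe, Subalgebra.coe_val]
      rw [tmul_mul_leg13, hrel, ← tmul_mul_leg13]
  rw [key, (LinearEquiv.symm_apply_eq _).2 hflip.symm, hE'E]

lemma Tmap1_F1A (hΔB : ∀ b ∈ B, Δ b = E * ((1 : A) ⊗ₜ[ℂ] b))
    (hm : LinearMap.mul' ℂ ↥B (TensorProduct.map LinearMap.id SC.toLinearMap E') = 1) :
    Tmap1 A Δ (F1A A B C E' SC) = E := by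
  have key : ∀ z : ↥B ⊗[ℂ] ↥C, Tmap1 A Δ (F1A A B C z SC) = E * ((1 : A) ⊗ₜ[ℂ]
      (LinearMap.mul' ℂ ↥B (TensorProduct.map LinearMap.id SC.toLinearMap z) : A)) := by
    intro z
    induction z using TensorProduct.induction_on with
    | zero => simp [F1A]
    | add x y hx hy =>
      simp only [F1A, map_add, tmul_add, mul_add, Subalgebra.coe_add] at hx hy ⊢; rw [hx, hy]
    | tmul b c => simp [F1A, hΔB b b.2, mul_assoc]
  rw [key, hm, Subalgebra.coe_one, ← Algebra.TensorProduct.one_def, mul_one]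

lemma Tmap3_F3A (hΔB : ∀ b ∈ B, Δ b = ((1 : A) ⊗ₜ[ℂ] b) * E)
    (hSB : ∀ b b' : ↥B, SB (b * b') = SB b' * SB b)
    (hm : LinearMap.mul' ℂ ↥C (TensorProduct.map SB.toLinearMap LinearMap.id E') = 1) :
    Tmap3 A Δ (F3A A B C E' SB) = E := by
  have key : ∀ z : ↥B ⊗[ℂ] ↥C, Tmap3 A Δ (F3A A B C z SB) = ((1 : A) ⊗ₜ[ℂ] (SB.symm
      (LinearMap.mul' ℂ ↥C (TensorProduct.map SB.toLinearMap LinearMap.id z)) : A)) * E := by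
    intro z
    induction z using TensorProduct.induction_on with
    | zero => simp [F3A]
    | add x y hx hy =>
      simp only [F3A, map_add, tmul_add, add_mul, Subalgebra.coe_add] at hx hy ⊢; rw [hx, hy]
    | tmul b c =>
      simp [F3A, hΔB b b.2, ← mul_assoc, symm_antimultiplicative SB hSB]
  rw [key, hm, map_one_of_antimultiplicative SB.symm (symm_antimultiplicative SB hSB),
    Subalgebra.coe_one, ← Algebra.TensorProduct.one_def, one_mul]

/-- A linear condition on `B` follows from its validity on the left slices of `E`. -/
lemma comp_val_eq_of_forall_sL {W : Type} [AddCommGroup W] [Module ℂ W] {f g : A →ₗ[ℂ] W}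
    (hE'E : TensorProduct.map B.val.toLinearMap C.val.toLinearMap E' = E)
    (hfull : Submodule.span ℂ {x : ↥B | ∃ ω : ↥C →ₗ[ℂ] ℂ, x = sL ω E'} = ⊤)
    (h : ∀ ω : A →ₗ[ℂ] ℂ, f (sL ω E) = g (sL ω E)) : ∀ b ∈ B, f b = g b := by
  have hfg : f ∘ₗ B.val.toLinearMap = g ∘ₗ B.val.toLinearMap := by
    apply LinearMap.ext_on hfull
    rintro _ ⟨ω, rfl⟩
    obtain ⟨ω', hω'⟩ := LinearMap.exists_leftInverse_of_injective C.val.toLinearMap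
      (LinearMap.ker_eq_bot.2 Subtype.val_injective)
    have := h (ω ∘ₗ ω')
    rwa [← hE'E, sL_map, LinearMap.comp_assoc, hω', LinearMap.comp_id] at this
  exact fun b hb ↦ LinearMap.congr_fun hfg ⟨b, hb⟩

lemma span_sL_comm
    (hfull : Submodule.span ℂ {y : ↥C | ∃ ω : ↥B →ₗ[ℂ] ℂ, y = sR ω E'} = ⊤) :
    Submodule.span ℂ {y : ↥C | ∃ ω : ↥B →ₗ[ℂ] ℂ,
      y = sL ω (TensorProduct.comm ℂ ↥B ↥C E')} = ⊤ := by
  simpa only [sL_comm] using hfull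

lemma map_val_comm
    (hE'E : TensorProduct.map B.val.toLinearMap C.val.toLinearMap E' = E) :
    TensorProduct.map C.val.toLinearMap B.val.toLinearMap (TensorProduct.comm ℂ ↥B ↥C E') =
      TensorProduct.comm ℂ A A E := by
  rw [← hE'E, TensorProduct.map_comm]

lemma ker_Tmap_eq_span_of_faithfulRightIntegrals
    (hΔmul : ∀ a a' : A, Δ (a * a') = Δ a * Δ a')
    (hΔcoassoc : ∀ a : A,
      TensorProduct.assoc ℂ A A A (LinearMap.rTensor A Δ (Δ a)) = LinearMap.lTensor A Δ (Δ a))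
    (hΔfull : Submodule.span ℂ {x : A | ∃ ω : A →ₗ[ℂ] ℂ, ∃ a : A, x = sL ω (Δ a)} = ⊤)
    (hEE : E * E = E)
    (hEΔ : ∀ a : A, E * Δ a = Δ a ∧ Δ a * E = Δ a)
    (hΔB : ∀ b ∈ B, Δ b = E * ((1 : A) ⊗ₜ[ℂ] b))
    (hΔB' : ∀ b ∈ B, Δ b = ((1 : A) ⊗ₜ[ℂ] b) * E)
    (hE'E : TensorProduct.map B.val.toLinearMap C.val.toLinearMap E' = E)
    (hE'full1 : Submodule.span ℂ {x : ↥B | ∃ ω : ↥C →ₗ[ℂ] ℂ, x = sL ω E'} = ⊤)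
    (hE'full2 : Submodule.span ℂ {y : ↥C | ∃ ω : ↥B →ₗ[ℂ] ℂ, y = sR ω E'} = ⊤)
    (hSBanti : ∀ b b' : ↥B, SB (b * b') = SB b' * SB b)
    (hSCanti : ∀ c c' : ↥C, SC (c * c') = SC c' * SC c)
    (hSBrel : ∀ b : ↥B, E' * (b ⊗ₜ[ℂ] (1 : ↥C)) = E' * ((1 : ↥B) ⊗ₜ[ℂ] SB b))
    (hSCrel : ∀ c : ↥C, ((1 : ↥B) ⊗ₜ[ℂ] c) * E' = (SC c ⊗ₜ[ℂ] (1 : ↥C)) * E')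
    (hfaith : FaithfulRightIntegrals A Δ B) :
    LinearMap.ker (Tmap1 A Δ) = Submodule.span ℂ {w : A ⊗[ℂ] A | ∃ a b : A,
        w = a ⊗ₜ[ℂ] b - (a ⊗ₜ[ℂ] (1 : A)) * F1A A B C E' SC * ((1 : A) ⊗ₜ[ℂ] b)} ∧
      LinearMap.ker (Tmap3 A Δ) = Submodule.span ℂ {w : A ⊗[ℂ] A | ∃ a b : A,
        w = a ⊗ₜ[ℂ] b - ((1 : A) ⊗ₜ[ℂ] b) * F3A A B C E' SB * (a ⊗ₜ[ℂ] (1 : A))} := by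
  have hE'E' : E' * E' = E' := map_val_injective (by rw [map_val_mul, hE'E, hEE])
  have hflip := antipodeFlip_eq_self hE'E' hE'full1 hSBanti hSCanti hSBrel hSCrel
  exact ⟨ker_Tmap1_eq_span hΔmul hΔcoassoc hΔfull (fun a ↦ (hEΔ a).2) hΔB'
      (leg13_mul_leg12_F1A hE'E hflip hSBrel)
      (Tmap1_F1A hΔB (mul'_map_id_right_antipode hE'E' hE'full1 hSCrel)) hfaith,
    ker_Tmap3_eq_span hΔmul hΔcoassoc hΔfull (fun a ↦ (hEΔ a).1) hΔB
      (leg12_F3A_mul_leg13 hE'E hflip hSCrel)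
      (Tmap3_F3A hΔB' hSBanti (mul'_map_left_antipode_id hE'E' hE'full2 hSBrel)) hfaith⟩

end Subalgebras

section Coopposite

variable {A : Type} [Ring A] [Algebra ℂ A] (Δ : A →ₗ[ℂ] A ⊗[ℂ] A)

/-- The coproduct followed by the flip. -/
noncomputable def coopposite : A →ₗ[ℂ] A ⊗[ℂ] A :=
  (TensorProduct.comm ℂ A A).toLinearMap ∘ₗ Δ

lemma coopposite_apply (a : A) : coopposite Δ a = TensorProduct.comm ℂ A A (Δ a) := rfl

variable {Δ}

lemma coopposite_coassoc
    (hΔcoassoc : ∀ a : A,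
      TensorProduct.assoc ℂ A A A (LinearMap.rTensor A Δ (Δ a)) = LinearMap.lTensor A Δ (Δ a))
    (a : A) :
    TensorProduct.assoc ℂ A A A (LinearMap.rTensor A (coopposite Δ) (coopposite Δ a)) =
      LinearMap.lTensor A (coopposite Δ) (coopposite Δ a) := by
  let flip13 : A ⊗[ℂ] (A ⊗[ℂ] A) →ₗ[ℂ] A ⊗[ℂ] (A ⊗[ℂ] A) :=
    (TensorProduct.assoc ℂ A A A).toLinearMap ∘ₗ
      (TensorProduct.comm ℂ A (A ⊗[ℂ] A)).toLinearMap ∘ₗ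
        LinearMap.lTensor A (TensorProduct.comm ℂ A A).toLinearMap
  have hflip (a b c : A) : flip13 (a ⊗ₜ (b ⊗ₜ c)) = c ⊗ₜ (b ⊗ₜ a) := rfl
  have hl : ∀ u : A ⊗[ℂ] A, TensorProduct.assoc ℂ A A A
      (LinearMap.rTensor A (coopposite Δ) (TensorProduct.comm ℂ A A u)) =
        flip13 (LinearMap.lTensor A Δ u) := by
    intro u
    induction u using TensorProduct.induction_on with
    | zero => simp
    | tmul c d => rfl
    | add x y hx hy => simp only [map_add, hx, hy]
  have hr : ∀ u : A ⊗[ℂ] A,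
      LinearMap.lTensor A (coopposite Δ) (TensorProduct.comm ℂ A A u) =
        flip13 (TensorProduct.assoc ℂ A A A (LinearMap.rTensor A Δ u)) := by
    intro u
    induction u using TensorProduct.induction_on with
    | zero => simp
    | add x y hx hy => simp only [map_add, hx, hy]
    | tmul c d =>
      simp only [TensorProduct.comm_tmul, LinearMap.lTensor_tmul, LinearMap.rTensor_tmul,
        coopposite_apply]
      induction Δ c using TensorProduct.induction_on with
      | zero => simp
      | tmul e f => simp [hflip]
      | add x y hx hy => simp only [map_add, tmul_add, add_tmul, hx, hy]
  rw [coopposite_apply, hl, hr, hΔcoassoc]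

lemma FaithfulLeftIntegrals.coopposite {C : Subalgebra ℂ A} (h : FaithfulLeftIntegrals A Δ C) :
    FaithfulRightIntegrals A (coopposite Δ) C := by
  simpa only [FaithfulRightIntegrals, FaithfulLeftIntegrals, IsRightIntegral, IsLeftIntegral,
    coopposite_apply, sR_comm] using h

lemma Tmap3_coopposite (w : A ⊗[ℂ] A) :
    Tmap3 A (coopposite Δ) (TensorProduct.comm ℂ A A w) =
      TensorProduct.comm ℂ A A (Tmap2 A Δ w) := by
  induction w using TensorProduct.induction_on with
  | zero => simp
  | tmul c d => simp [comm_mul, coopposite_apply]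
  | add x y hx hy => simp only [map_add, hx, hy]

lemma Tmap1_coopposite (w : A ⊗[ℂ] A) :
    Tmap1 A (coopposite Δ) (TensorProduct.comm ℂ A A w) =
      TensorProduct.comm ℂ A A (Tmap4 A Δ w) := by
  induction w using TensorProduct.induction_on with
  | zero => simp
  | tmul c d => simp [comm_mul, coopposite_apply]
  | add x y hx hy => simp only [map_add, hx, hy]

/-- Transport of a description of a kernel along the flip. -/
lemma ker_eq_span_of_comm {T T' : A ⊗[ℂ] A →ₗ[ℂ] A ⊗[ℂ] A} {s : A → A → A ⊗[ℂ] A}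
    (hT : ∀ w, T' (TensorProduct.comm ℂ A A w) = TensorProduct.comm ℂ A A (T w))
    (h : LinearMap.ker T' = Submodule.span ℂ {w | ∃ a b, w = TensorProduct.comm ℂ A A (s b a)}) :
    LinearMap.ker T = Submodule.span ℂ {w | ∃ a b, w = s a b} := by
  have hset : {w | ∃ a b, w = TensorProduct.comm ℂ A A (s b a)} =
      (TensorProduct.comm ℂ A A).toLinearMap '' {w | ∃ a b, w = s a b} := by
    ext w
    constructor
    · rintro ⟨a, b, rfl⟩
      exact ⟨_, ⟨b, a, rfl⟩, rfl⟩
    · rintro ⟨_, ⟨a, b, rfl⟩, rfl⟩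
      exact ⟨b, a, rfl⟩
  rw [hset, ← Submodule.map_span] at h
  ext w
  rw [LinearMap.mem_ker, ← (TensorProduct.comm ℂ A A).map_eq_zero_iff, ← hT, ← LinearMap.mem_ker, h]
  exact Submodule.map_equiv_eq_comap_symm (TensorProduct.comm ℂ A A) _ ▸ by simp

end Coopposite

theorem statement15
    (A : Type) [Ring A] [Algebra ℂ A]
    (Δ : A →ₗ[ℂ] A ⊗[ℂ] A)
    (hΔmul : ∀ a a' : A, Δ (a * a') = Δ a * Δ a')
    (hΔcoassoc : ∀ a : A,
      TensorProduct.assoc ℂ A A A (LinearMap.rTensor A Δ (Δ a)) = LinearMap.lTensor A Δ (Δ a))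
    (hΔfullL : Submodule.span ℂ {x : A | ∃ ω : A →ₗ[ℂ] ℂ, ∃ a : A, x = sL ω (Δ a)} = ⊤)
    (hΔfullR : Submodule.span ℂ {x : A | ∃ ω : A →ₗ[ℂ] ℂ, ∃ a : A, x = sR ω (Δ a)} = ⊤)
    (E : A ⊗[ℂ] A)
    (hEE : E * E = E)
    (hEΔ : ∀ a : A, E * Δ a = Δ a ∧ Δ a * E = Δ a)
    (hranL : (Submodule.span ℂ {y : A ⊗[ℂ] A | ∃ a z, y = Δ a * z} : Set (A ⊗[ℂ] A)) =
      {y : A ⊗[ℂ] A | ∃ z, y = E * z})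
    (hranR : (Submodule.span ℂ {y : A ⊗[ℂ] A | ∃ a z, y = z * Δ a} : Set (A ⊗[ℂ] A)) =
      {y : A ⊗[ℂ] A | ∃ z, y = z * E})
    (hΔE1 : TensorProduct.assoc ℂ A A A (LinearMap.rTensor A Δ E) =
      leg12 A E * ((1 : A) ⊗ₜ[ℂ] E))
    (hΔE2 : leg12 A E * ((1 : A) ⊗ₜ[ℂ] E) = ((1 : A) ⊗ₜ[ℂ] E) * leg12 A E)
    (B C : Subalgebra ℂ A)
    (E' : ↥B ⊗[ℂ] ↥C)
    (hE'E : TensorProduct.map B.val.toLinearMap C.val.toLinearMap E' = E)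
    (hE'full1 : Submodule.span ℂ {x : ↥B | ∃ ω : ↥C →ₗ[ℂ] ℂ, x = sL ω E'} = ⊤)
    (hE'full2 : Submodule.span ℂ {y : ↥C | ∃ ω : ↥B →ₗ[ℂ] ℂ, y = sR ω E'} = ⊤)
    (SB : ↥B ≃ₗ[ℂ] ↥C) (SC : ↥C ≃ₗ[ℂ] ↥B)
    (hSBanti : ∀ b b' : ↥B, SB (b * b') = SB b' * SB b)
    (hSCanti : ∀ c c' : ↥C, SC (c * c') = SC c' * SC c)
    (hSBrel : ∀ b : ↥B, E' * (b ⊗ₜ[ℂ] (1 : ↥C)) = E' * ((1 : ↥B) ⊗ₜ[ℂ] SB b))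
    (hSCrel : ∀ c : ↥C, ((1 : ↥B) ⊗ₜ[ℂ] c) * E' = (SC c ⊗ₜ[ℂ] (1 : ↥C)) * E')
 :
    (FaithfulRightIntegrals A Δ B →
      LinearMap.ker (Tmap1 A Δ) = Submodule.span ℂ {w : A ⊗[ℂ] A | ∃ a b : A,
        w = a ⊗ₜ[ℂ] b - (a ⊗ₜ[ℂ] (1 : A)) * F1A A B C E' SC * ((1 : A) ⊗ₜ[ℂ] b)} ∧
      LinearMap.ker (Tmap3 A Δ) = Submodule.span ℂ {w : A ⊗[ℂ] A | ∃ a b : A,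
        w = a ⊗ₜ[ℂ] b - ((1 : A) ⊗ₜ[ℂ] b) * F3A A B C E' SB * (a ⊗ₜ[ℂ] (1 : A))}) ∧
    (FaithfulLeftIntegrals A Δ C →
      LinearMap.ker (Tmap2 A Δ) = Submodule.span ℂ {w : A ⊗[ℂ] A | ∃ a b : A,
        w = a ⊗ₜ[ℂ] b - (a ⊗ₜ[ℂ] (1 : A)) * F2A A B C E' SB * ((1 : A) ⊗ₜ[ℂ] b)} ∧
      LinearMap.ker (Tmap4 A Δ) = Submodule.span ℂ {w : A ⊗[ℂ] A | ∃ a b : A,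
        w = a ⊗ₜ[ℂ] b - ((1 : A) ⊗ₜ[ℂ] b) * F4A A B C E' SC * (a ⊗ₜ[ℂ] (1 : A))}) := by
  have hΔ1 : Δ 1 = E := by
    have hmem : E ∈ (Submodule.span ℂ {y : A ⊗[ℂ] A | ∃ a z, y = Δ a * z} : Set (A ⊗[ℂ] A)) := by
      rw [hranL]
      exact ⟨1, (mul_one E).symm⟩
    have hid : ∀ y ∈ Submodule.span ℂ {y : A ⊗[ℂ] A | ∃ a z, y = Δ a * z}, Δ 1 * y = y := by
      intro y hy
      induction hy using Submodule.span_induction with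
      | mem y hy =>
        obtain ⟨a, z, rfl⟩ := hy
        rw [← mul_assoc, ← hΔmul, one_mul]
      | zero => simp
      | add x y _ _ hx hy => rw [mul_add, hx, hy]
      | smul c x _ hx => rw [mul_smul_comm, hx]
    rw [← (hEΔ 1).2, hid E hmem]
  have hE1Δ : LinearMap.lTensor A Δ E = leg12 A E * ((1 : A) ⊗ₜ[ℂ] E) := by
    rw [← hΔE1, ← hΔ1, hΔcoassoc]
  have hΔB : ∀ b ∈ B, Δ b = E * ((1 : A) ⊗ₜ[ℂ] b) := by
    refine comp_val_eq_of_forall_sL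
      (g := LinearMap.mulLeft ℂ E ∘ₗ TensorProduct.mk ℂ A A 1) hE'E hE'full1 fun ω ↦ ?_
    rw [← sL_rTensor, ← (TensorProduct.assoc ℂ A A A).symm_apply_apply (LinearMap.rTensor A Δ E),
      hΔE1, sL_assoc_symm_leg12_mul]
    rfl
  have hΔB' : ∀ b ∈ B, Δ b = ((1 : A) ⊗ₜ[ℂ] b) * E := by
    refine comp_val_eq_of_forall_sL
      (g := LinearMap.mulRight ℂ E ∘ₗ TensorProduct.mk ℂ A A 1) hE'E hE'full1 fun ω ↦ ?_
    rw [← sL_rTensor, ← (TensorProduct.assoc ℂ A A A).symm_apply_apply (LinearMap.rTensor A Δ E),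
      hΔE1, hΔE2, sL_assoc_symm_mul_leg12]
    rfl
  refine ⟨ker_Tmap_eq_span_of_faithfulRightIntegrals hΔmul hΔcoassoc hΔfullL hEE hEΔ hΔB hΔB' hE'E
    hE'full1 hE'full2 hSBanti hSCanti hSBrel hSCrel, fun hfaith ↦ ?_⟩
  have hcommE := map_val_comm hE'E
  have hE'full1' := span_sL_comm hE'full2
  have hE'full2' : Submodule.span ℂ {y : ↥B | ∃ ω : ↥C →ₗ[ℂ] ℂ,
      y = sR ω (TensorProduct.comm ℂ ↥B ↥C E')} = ⊤ := by
    simpa only [sR_comm] using hE'full1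
  have hΔC : ∀ c ∈ C, coopposite Δ c = TensorProduct.comm ℂ A A E * ((1 : A) ⊗ₜ[ℂ] c) := by
    refine comp_val_eq_of_forall_sL (g := LinearMap.mulLeft ℂ (TensorProduct.comm ℂ A A E) ∘ₗ
      TensorProduct.mk ℂ A A 1) hcommE hE'full1' fun ω ↦ ?_
    rw [sL_comm, coopposite_apply, ← sR_lTensor, hE1Δ, hΔE2, sR_one_tmul_mul_leg12, comm_mul]
    rfl
  have hΔC' : ∀ c ∈ C, coopposite Δ c = ((1 : A) ⊗ₜ[ℂ] c) * TensorProduct.comm ℂ A A E := by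
    refine comp_val_eq_of_forall_sL (g := LinearMap.mulRight ℂ (TensorProduct.comm ℂ A A E) ∘ₗ
      TensorProduct.mk ℂ A A 1) hcommE hE'full1' fun ω ↦ ?_
    rw [sL_comm, coopposite_apply, ← sR_lTensor, hE1Δ, sR_leg12_mul_one_tmul, comm_mul]
    rfl
  have hcop := ker_Tmap_eq_span_of_faithfulRightIntegrals (Δ := coopposite Δ)
    (SB := SB.symm) (SC := SC.symm)
    (fun a a' ↦ by simp only [coopposite_apply, hΔmul, comm_mul])
    (coopposite_coassoc hΔcoassoc)
    (by simpa only [coopposite_apply, sL_comm] using hΔfullR)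
    (by rw [← comm_mul, hEE])
    (fun a ↦ by
      simp only [coopposite_apply, ← comm_mul, (hEΔ a).1, (hEΔ a).2, and_self])
    hΔC hΔC' hcommE hE'full1' hE'full2'
    (symm_antimultiplicative SB hSBanti) (symm_antimultiplicative SC hSCanti)
    (fun c ↦ by
      have h := congrArg (TensorProduct.comm ℂ ↥B ↥C) (hSBrel (SB.symm c))
      simpa only [comm_mul, TensorProduct.comm_tmul, LinearEquiv.apply_symm_apply] using h.symm)
    (fun b ↦ by
      have h := congrArg (TensorProduct.comm ℂ ↥B ↥C) (hSCrel (SC.symm b))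
      simpa only [comm_mul, TensorProduct.comm_tmul, LinearEquiv.apply_symm_apply] using h.symm)
    hfaith.coopposite
  have hF2 : F3A A C B (TensorProduct.comm ℂ ↥B ↥C E') SB.symm =
      TensorProduct.comm ℂ A A (F2A A B C E' SB) := by
    rw [F2A, F3A, LinearEquiv.symm_symm, TensorProduct.map_comm]
  have hF4 : F1A A C B (TensorProduct.comm ℂ ↥B ↥C E') SC.symm =
      TensorProduct.comm ℂ A A (F4A A B C E' SC) := by
    rw [F4A, F1A, TensorProduct.map_comm]
  refine ⟨ker_eq_span_of_comm Tmap3_coopposite ?_, ker_eq_span_of_comm Tmap1_coopposite ?_⟩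
  · simpa only [map_sub, comm_mul, TensorProduct.comm_tmul, hF2] using hcop.2
  · simpa only [map_sub, comm_mul, TensorProduct.comm_tmul, hF4] using hcop.1
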